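/- Let A be a polynomial vector field on ℂ^p with m(A) > 0 and let P ∈ ℂ[z₁,…,z_p]. On the open disc {t ∈ ℂ : |t| < 1/m(A)}, the function t ↦ φ_t(P) := Σ_{n≥0} (t^n/n!)·coeff_0(D_A^n(P)) is complex differentiable, with derivative (d/dt)φ_t(P) = φ_t(D_A(P)). -/

import Mathlib

open MvPolynomial

noncomputable def vfDeriv {p : ℕ} (A : Fin p → MvPolynomial (Fin p) ℂ)
    (P : MvPolynomial (Fin p) ℂ) : MvPolynomial (Fin p) ℂ :=
  ∑ i, A i * pderiv i P

noncomputable def vfNorm {p : ℕ} (A : Fin p → MvPolynomial (Fin p) ℂ) : ℝ :=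
  ⨆ i, ∑ m ∈ (A i).support, ‖(A i).coeff m‖


/-- `vfDeriv A` as a linear endomorphism. -/
noncomputable def vfDerivEnd {p : ℕ} (A : Fin p → MvPolynomial (Fin p) ℂ) :
    Module.End ℂ (MvPolynomial (Fin p) ℂ) :=
  ∑ i, LinearMap.mulLeft ℂ (A i) ∘ₗ (pderiv i).toLinearMap

lemma vfDerivEnd_apply {p : ℕ} (A : Fin p → MvPolynomial (Fin p) ℂ)
    (P : MvPolynomial (Fin p) ℂ) : vfDerivEnd A P = vfDeriv A P := by
  simp [vfDerivEnd, vfDeriv]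

/-- The linear functional `P ↦ coeff_0 (D_A^n P)`. -/
noncomputable def vfCoeff {p : ℕ} (A : Fin p → MvPolynomial (Fin p) ℂ) (n : ℕ) :
    MvPolynomial (Fin p) ℂ →ₗ[ℂ] ℂ :=
  lcoeff ℂ 0 ∘ₗ (vfDerivEnd A) ^ n

lemma vfCoeff_apply {p : ℕ} (A : Fin p → MvPolynomial (Fin p) ℂ) (n : ℕ)
    (P : MvPolynomial (Fin p) ℂ) : vfCoeff A n P = coeff 0 ((vfDeriv A)^[n] P) := by
  have h : ⇑(vfDerivEnd A) = vfDeriv A := funext (vfDerivEnd_apply A)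
  simp [vfCoeff, Module.End.pow_apply, h]

lemma vfCoeff_succ {p : ℕ} (A : Fin p → MvPolynomial (Fin p) ℂ) (n : ℕ)
    (P : MvPolynomial (Fin p) ℂ) : vfCoeff A (n + 1) P = vfCoeff A n (vfDeriv A P) := by
  simp [vfCoeff_apply]

lemma mul_monomial_eq_sum {σ R : Type*} [CommSemiring R] (Q : MvPolynomial σ R) (k : σ →₀ ℕ)
    (a : R) :
    Q * monomial k a = ∑ m ∈ Q.support, (Q.coeff m * a) • monomial (m + k) (1 : R) := by
  conv_lhs => rw [Q.as_sum, Finset.sum_mul]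
  simp [monomial_mul, smul_monomial]

lemma norm_apply_mul_monomial_le {σ : Type*} (L : MvPolynomial σ ℂ →ₗ[ℂ] ℂ) {B : ℝ}
    (hB : ∀ k, ‖L (monomial k 1)‖ ≤ B) (Q : MvPolynomial σ ℂ) (k : σ →₀ ℕ) (a : ℂ) :
    ‖L (Q * monomial k a)‖ ≤ (∑ m ∈ Q.support, ‖Q.coeff m‖) * ‖a‖ * B := by
  rw [mul_monomial_eq_sum, map_sum, Finset.sum_mul, Finset.sum_mul]
  refine norm_sum_le_of_le _ fun m _ => ?_
  rw [map_smul, smul_eq_mul, norm_mul, norm_mul]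
  gcongr
  exact hB _

lemma le_vfNorm {p : ℕ} (A : Fin p → MvPolynomial (Fin p) ℂ) (i : Fin p) :
    ∑ m ∈ (A i).support, ‖(A i).coeff m‖ ≤ vfNorm A :=
  le_ciSup (f := fun i => ∑ m ∈ (A i).support, ‖(A i).coeff m‖) (Set.finite_range _).bddAbove i

lemma vfDeriv_monomial {p : ℕ} (A : Fin p → MvPolynomial (Fin p) ℂ) (k : Fin p →₀ ℕ) :
    vfDeriv A (monomial k 1) = ∑ i, A i * monomial (k - Finsupp.single i 1) (k i : ℂ) := by
  simp [vfDeriv, pderiv_monomial]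

lemma vfCoeff_monomial_eq_zero {p : ℕ} (A : Fin p → MvPolynomial (Fin p) ℂ) (n : ℕ)
    (k : Fin p →₀ ℕ) (hk : n < k.degree) : vfCoeff A n (monomial k 1) = 0 := by
  induction n generalizing k with
  | zero =>
    have : k ≠ 0 := by rintro rfl; simp at hk
    simp [vfCoeff_apply, coeff_monomial, this]
  | succ n ih =>
    rw [vfCoeff_succ, vfDeriv_monomial, map_sum]
    refine Finset.sum_eq_zero fun i _ => ?_
    rcases Nat.eq_zero_or_pos (k i) with h0 | h0
    · simp [h0]
    rw [mul_monomial_eq_sum, map_sum]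
    refine Finset.sum_eq_zero fun m _ => ?_
    have hle : Finsupp.single i 1 ≤ k := by simpa [Nat.one_le_iff_ne_zero] using h0.ne'
    have hdeg : (k - Finsupp.single i 1).degree + 1 = k.degree := by
      conv_rhs => rw [← tsub_add_cancel_of_le hle, map_add, Finsupp.degree_single]
    rw [map_smul, ih _ (by rw [map_add]; omega), smul_zero]

lemma norm_vfCoeff_monomial_le {p : ℕ} (A : Fin p → MvPolynomial (Fin p) ℂ)
    (hm : 0 ≤ vfNorm A) (n : ℕ) (k : Fin p →₀ ℕ) :
    ‖vfCoeff A n (monomial k 1)‖ ≤ n.factorial * vfNorm A ^ n := by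
  induction n generalizing k with
  | zero =>
    simp only [vfCoeff_apply, Function.iterate_zero, id, coeff_monomial]
    split_ifs <;> simp
  | succ n ih =>
    rcases lt_or_ge (n + 1) k.degree with hk | hk
    · rw [vfCoeff_monomial_eq_zero A _ k hk, norm_zero]
      positivity
    rw [vfCoeff_succ, vfDeriv_monomial, map_sum]
    calc ‖∑ i, vfCoeff A n (A i * monomial (k - Finsupp.single i 1) (k i : ℂ))‖
        ≤ ∑ i, vfNorm A * (k i : ℝ) * (n.factorial * vfNorm A ^ n) := by
          refine norm_sum_le_of_le _ fun i _ => ?_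
          refine (norm_apply_mul_monomial_le _ ih _ _ _).trans ?_
          rw [Complex.norm_natCast]
          gcongr
          exact le_vfNorm A i
      _ = (k.degree : ℝ) * (n.factorial * vfNorm A ^ (n + 1)) := by
          rw [← Finset.sum_mul, ← Finset.mul_sum, Finsupp.degree_eq_sum]
          push_cast
          ring
      _ ≤ ((n + 1 : ℕ) : ℝ) * (n.factorial * vfNorm A ^ (n + 1)) := by gcongr
      _ = _ := by rw [Nat.factorial_succ]; push_cast; ring

lemma norm_vfCoeff_le {p : ℕ} (A : Fin p → MvPolynomial (Fin p) ℂ)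
    (hm : 0 ≤ vfNorm A) (n : ℕ) (P : MvPolynomial (Fin p) ℂ) :
    ‖vfCoeff A n P‖ ≤ (∑ m ∈ P.support, ‖P.coeff m‖) * (n.factorial * vfNorm A ^ n) := by
  simpa using norm_apply_mul_monomial_le _ (norm_vfCoeff_monomial_le A hm n) P 0 1

/-- Termwise differentiation of an exponential generating series whose coefficients are
`O(n! M ^ n)`. -/
lemma hasDerivAt_tsum_pow_div_factorial {c : ℕ → ℂ} {C M : ℝ} (hM : 0 < M)
    (hc : ∀ n, ‖c n‖ ≤ C * (n.factorial * M ^ n)) {t : ℂ} (ht : ‖t‖ < 1 / M) :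
    HasDerivAt (fun s : ℂ => ∑' n : ℕ, s ^ n / (n.factorial : ℂ) * c n)
      (∑' n : ℕ, t ^ n / (n.factorial : ℂ) * c (n + 1)) t := by
  obtain ⟨r, htr, hr⟩ := exists_between ht
  have hr0 : 0 < r := (norm_nonneg t).trans_lt htr
  have hrM : r * M < 1 := (lt_div_iff₀ hM).1 hr
  set g : ℕ → ℂ → ℂ := fun n s => n * s ^ (n - 1) / (n.factorial : ℂ) * c n with hg
  have hu : Summable fun n : ℕ => C / r * (n * (r * M) ^ n) := by
    refine Summable.mul_left _ ?_
    simpa using summable_pow_mul_geometric_of_norm_lt_one 1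
      (r := r * M) (by rwa [Real.norm_of_nonneg (by positivity)])
  have hbound : ∀ n s, s ∈ Metric.ball (0 : ℂ) r → ‖g n s‖ ≤ C / r * (n * (r * M) ^ n) := by
    intro n s hs
    rw [mem_ball_zero_iff] at hs
    rcases n with _ | n
    · simp [hg]
    have hf : (0 : ℝ) < (n + 1).factorial := by positivity
    calc ‖g (n + 1) s‖ = (n + 1 : ℕ) * ‖s‖ ^ n / (n + 1).factorial * ‖c (n + 1)‖ := by
          simp only [hg, norm_mul, norm_div, norm_pow, Complex.norm_natCast, Nat.add_sub_cancel]
      _ ≤ (n + 1 : ℕ) * r ^ n / (n + 1).factorial * (C * ((n + 1).factorial * M ^ (n + 1))) := by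
          gcongr
          exact hc _
      _ = _ := by field_simp; ring
  have hmem : t ∈ Metric.ball (0 : ℂ) r := by simpa using htr
  have hderiv := hasDerivAt_tsum_of_isPreconnected hu Metric.isOpen_ball
    (convex_ball (0 : ℂ) r).isPreconnected
    (g := fun n s => s ^ n / (n.factorial : ℂ) * c n) (g' := g) (y₀ := 0)
    (fun n s _ => ((hasDerivAt_pow n s).div_const _).mul_const _) hbound
    (Metric.mem_ball_self hr0)
    (summable_of_ne_finset_zero (s := {0}) fun n hn => by
      simp [zero_pow (by simpa using hn : n ≠ 0)]) hmem
  have hsum : Summable fun n => g n t := Summable.of_norm_bounded hu fun n => hbound n t hmem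
  refine hderiv.congr_deriv (hsum.tsum_eq_zero_add.trans ?_)
  simp only [hg, Nat.cast_zero, zero_mul, zero_div, zero_add, Nat.add_sub_cancel]
  refine tsum_congr fun n => ?_
  have h1 : ((n + 1 : ℕ) : ℂ) ≠ 0 := Nat.cast_ne_zero.2 n.succ_ne_zero
  rw [Nat.factorial_succ, Nat.cast_mul, mul_div_mul_left _ _ h1]

/-- for `m(A) > 0`, on the open disc `{t : |t| < 1/m(A)}` the function
`t ↦ φ_t(P) := Σ_{n≥0} (t^n/n!)·coeff_0(D_A^n(P))` is complex differentiable with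
derivative `φ_t(D_A(P))`. -/
theorem stmt_12 (p : ℕ) (hp : 0 < p) (A : Fin p → MvPolynomial (Fin p) ℂ)
    (hm : 0 < vfNorm A) (P : MvPolynomial (Fin p) ℂ) (t : ℂ)
    (ht : ‖t‖ < 1 / vfNorm A) :
    HasDerivAt
      (fun s : ℂ => ∑' n : ℕ, (s ^ n / (Nat.factorial n : ℂ)) *
        coeff 0 ((vfDeriv A)^[n] P))
      (∑' n : ℕ, (t ^ n / (Nat.factorial n : ℂ)) *
        coeff 0 ((vfDeriv A)^[n] (vfDeriv A P)))
      t := by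
  simpa only [vfCoeff_succ, vfCoeff_apply] using
    hasDerivAt_tsum_pow_div_factorial hm (fun n => norm_vfCoeff_le A hm.le n P) ht
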